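/- (Summable step sizes, consequence of the proof of Theorem 1.) Under the hypotheses of Theorem 1 — ℓ : ℝⁿ → ℝ differentiable with β-Lipschitz gradient and bounded below by M, c > 0, vectors dᵗ with entries ≥ β + c, and for every t ≥ 1 the inequality ⟨∇ℓ(ŵ^{t−1}), ŵᵗ − ŵ^{t−1}⟩ + (1/2)·∑ᵢ (d^{t−1})ᵢ (ŵᵗᵢ − ŵ^{t−1}ᵢ)² ≤ 0 — it holds for every T ≥ 1 that ∑_{t=1}^{T} ‖ŵᵗ − ŵ^{t−1}‖₂² ≤ (2/c)·(ℓ(ŵ⁰) − M); in particular the series ∑_{t≥1} ‖ŵᵗ − ŵ^{t−1}‖₂² converges. -/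

import Mathlib

open scoped RealInnerProductSpace

lemma descent_aux (n : ℕ) (ℓ : EuclideanSpace ℝ (Fin n) → ℝ) (β : ℝ)
    (hdiff : Differentiable ℝ ℓ)
    (hlip : ∀ u v, ‖gradient ℓ u - gradient ℓ v‖ ≤ β * ‖u - v‖)
    (x v : EuclideanSpace ℝ (Fin n)) :
    ℓ (x + v) ≤ ℓ x + ⟪gradient ℓ x, v⟫ + β / 2 * ‖v‖ ^ 2 := by
  have hg : ∀ s : ℝ, HasDerivAt
      (fun s : ℝ => ℓ (x + s • v) - s * ⟪gradient ℓ x, v⟫ - β / 2 * ‖v‖ ^ 2 * s ^ 2)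
      (⟪gradient ℓ (x + s • v), v⟫ - ⟪gradient ℓ x, v⟫ - β * ‖v‖ ^ 2 * s) s := by
    intro s
    have h1 : HasDerivAt (fun s : ℝ => x + s • v) v s := by
      simpa using ((hasDerivAt_id s).smul_const v).const_add x
    have h2 := ((hdiff (x + s • v)).hasGradientAt.hasFDerivAt).comp_hasDerivAt s h1
    have h3 := (hasDerivAt_id s).mul_const ⟪gradient ℓ x, v⟫
    have h4 := ((hasDerivAt_id s).pow 2).const_mul (β / 2 * ‖v‖ ^ 2)
    have h5 := (h2.sub h3).sub h4
    refine h5.congr_deriv ?_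
    simp
    ring
  have hanti := antitoneOn_of_deriv_nonpos (convex_Icc (0 : ℝ) 1)
    (fun s _ => (hg s).continuousAt.continuousWithinAt)
    (fun s _ => (hg s).differentiableAt.differentiableWithinAt)
    (by
      intro s hs
      rw [interior_Icc] at hs
      rw [(hg s).deriv, ← inner_sub_left]
      have h1 := real_inner_le_norm (gradient ℓ (x + s • v) - gradient ℓ x) v
      have h2 := hlip (x + s • v) x
      rw [add_sub_cancel_left, norm_smul, Real.norm_of_nonneg hs.1.le] at h2
      have h3 := mul_le_mul_of_nonneg_right h2 (norm_nonneg v)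
      nlinarith)
  have := hanti (Set.left_mem_Icc.2 zero_le_one) (Set.right_mem_Icc.2 zero_le_one) zero_le_one
  simp only [one_smul, zero_smul, add_zero, one_mul, zero_mul, one_pow, mul_one, sub_zero, ne_eq,
    OfNat.ofNat_ne_zero, not_false_eq_true, zero_pow, mul_zero] at this
  linarith

/-- Summable step sizes (consequence of the proof of Theorem 1): under the hypotheses
of Theorem 1 with `ℓ` bounded below by `M`, for every `T ≥ 1`,
`∑_{t=1}^{T} ‖ŵᵗ − ŵ^{t−1}‖₂² ≤ (2/c)·(ℓ(ŵ⁰) − M)`; in particular the series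
`∑_{t≥1} ‖ŵᵗ − ŵ^{t−1}‖₂²` converges. -/
theorem stmt_11 (n : ℕ) (ℓ : EuclideanSpace ℝ (Fin n) → ℝ) (β : ℝ)
    (hdiff : Differentiable ℝ ℓ)
    (hlip : ∀ u v, ‖gradient ℓ u - gradient ℓ v‖ ≤ β * ‖u - v‖)
    (M : ℝ) (hbdd : ∀ x, M ≤ ℓ x)
    (c : ℝ) (hc : 0 < c)
    (w : ℕ → EuclideanSpace ℝ (Fin n)) (d : ℕ → Fin n → ℝ)
    (hd : ∀ t i, β + c ≤ d t i)
    (hmin : ∀ t : ℕ, ⟪gradient ℓ (w t), w (t + 1) - w t⟫ +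
      (1 / 2) * ∑ i, d t i * (w (t + 1) i - w t i) ^ 2 ≤ 0) :
    (∀ T : ℕ, 1 ≤ T →
        ∑ t ∈ Finset.range T, ‖w (t + 1) - w t‖ ^ 2 ≤ (2 / c) * (ℓ (w 0) - M)) ∧
      Summable (fun t : ℕ => ‖w (t + 1) - w t‖ ^ 2) := by
  have step : ∀ t, c / 2 * ‖w (t + 1) - w t‖ ^ 2 ≤ ℓ (w t) - ℓ (w (t + 1)) := by
    intro t
    have h1 := descent_aux n ℓ β hdiff hlip (w t) (w (t + 1) - w t)
    rw [add_sub_cancel] at h1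
    have h2 := hmin t
    have h3 : (β + c) * ‖w (t + 1) - w t‖ ^ 2 ≤ ∑ i, d t i * (w (t + 1) i - w t i) ^ 2 := by
      rw [EuclideanSpace.real_norm_sq_eq, Finset.mul_sum]
      exact Finset.sum_le_sum fun i _ => mul_le_mul_of_nonneg_right (hd t i) (sq_nonneg _)
    linarith
  have main : ∀ T : ℕ,
      ∑ t ∈ Finset.range T, ‖w (t + 1) - w t‖ ^ 2 ≤ (2 / c) * (ℓ (w 0) - M) := by
    intro T
    have h1 : ∑ t ∈ Finset.range T, c / 2 * ‖w (t + 1) - w t‖ ^ 2 ≤ ℓ (w 0) - ℓ (w T) := by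
      rw [← Finset.sum_range_sub' (fun t => ℓ (w t))]
      exact Finset.sum_le_sum fun t _ => step t
    rw [← Finset.mul_sum] at h1
    have h2 := hbdd (w T)
    rw [div_mul_eq_mul_div, le_div_iff₀ hc]
    linarith
  exact ⟨fun T _ => main T, summable_of_sum_range_le (fun _ => sq_nonneg _) main⟩
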